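/- Assume the Gibbs kernel k_ε is strictly positive definite. Let α, β be Borel probability measures on X, and let p_α, p_β be continuous symmetric potentials, i.e. p_α = T_ε(α, p_α) and p_β = T_ε(β, p_β) on all of X. Then the Hausdorff divergence is dominated by the Sinkhorn divergence: ½ ∫ (p_β − p_α) d(α − β) ≤ S_ε(α, β). -/

import Mathlib

open MeasureTheory Real Filter Topology
open scoped NNReal ENNReal

/-- The entropic dual functional `D_ε(α, β; f, g)`. -/
noncomputable def Dfun {X : Type*} [MeasurableSpace X] (eps : ℝ) (C : X → X → ℝ)
    (alpha beta : Measure X) (f g : X → ℝ) : ℝ :=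
  (∫ x, f x ∂alpha) + (∫ y, g y ∂beta) -
    eps * ∫ x, ∫ y, (Real.exp ((f x + g y - C x y) / eps) - 1) ∂beta ∂alpha

/-- The entropic transport cost `OT_ε(α, β)`, as a supremum of the dual
functional over pairs of continuous potentials. -/
noncomputable def OTcost {X : Type*} [TopologicalSpace X] [MeasurableSpace X] (eps : ℝ) (C : X → X → ℝ)
    (alpha beta : Measure X) : ℝ :=
  sSup {r : ℝ | ∃ f g : X → ℝ, Continuous f ∧ Continuous g ∧ r = Dfun eps C alpha beta f g}

/-- The Sinkhorn divergence `S_ε(α, β)`. -/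
noncomputable def Sinkhorn {X : Type*} [TopologicalSpace X] [MeasurableSpace X] (eps : ℝ) (C : X → X → ℝ)
    (alpha beta : Measure X) : ℝ :=
  OTcost eps C alpha beta - (1/2) * OTcost eps C alpha alpha - (1/2) * OTcost eps C beta beta

/-- The squared kernel norm `‖ξ‖²_k = ∫∫ k dξ dξ` of the finite signed measure
`ξ = μ - ν`, written out in terms of its positive and negative parts. -/
noncomputable def kerQuad {X : Type*} [MeasurableSpace X] (k : X → X → ℝ)
    (mu nu : Measure X) : ℝ :=
  ∫ x, ∫ y, k x y ∂mu ∂mu - ∫ x, ∫ y, k x y ∂nu ∂mu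
    - ∫ x, ∫ y, k x y ∂mu ∂nu + ∫ x, ∫ y, k x y ∂nu ∂nu

/-- A kernel is strictly positive definite if `‖ξ‖²_k > 0` for every nonzero
finite signed Borel measure `ξ = μ - ν`. -/
def StrictPosDef {X : Type*} [MeasurableSpace X] (k : X → X → ℝ) : Prop :=
  ∀ mu nu : Measure X, IsFiniteMeasure mu → IsFiniteMeasure nu → mu ≠ nu →
    0 < kerQuad k mu nu

/-- The Sinkhorn map `T_ε(α, f)(y) = -ε log ∫ exp((f(x) - C(x,y))/ε) dα(x)`. -/
noncomputable def Tmap {X : Type*} [MeasurableSpace X] (eps : ℝ) (C : X → X → ℝ)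
    (alpha : Measure X) (f : X → ℝ) : X → ℝ :=
  fun y => -eps * Real.log (∫ x, Real.exp ((f x - C x y) / eps) ∂alpha)

theorem Continuous.integrable_of_compactSpace {Y : Type*} [TopologicalSpace Y] [CompactSpace Y]
    [MeasurableSpace Y] [OpensMeasurableSpace Y] {mu : Measure Y} [IsFiniteMeasure mu]
    {f : Y → ℝ} (hf : Continuous f) : Integrable f mu :=
  hf.integrable_of_hasCompactSupport (HasCompactSupport.of_compactSpace f)

/-- The density `exp((p(x) + p(y) - C(x, y)) / ε)` of the plan attached to a symmetric potential. -/
noncomputable def gibbsDensity {X : Type*} (eps : ℝ) (C : X → X → ℝ) (p : X → ℝ) (z : X × X) : ℝ :=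
  Real.exp ((p z.1 + p z.2 - C z.1 z.2) / eps)

theorem continuous_gibbsDensity {X : Type*} [TopologicalSpace X] {eps : ℝ} {C : X → X → ℝ}
    {p : X → ℝ} (hC : Continuous fun z : X × X => C z.1 z.2)
    (hp : Continuous p) :
    Continuous (gibbsDensity eps C p) := by
  unfold gibbsDensity
  fun_prop

theorem gibbsDensity_swap {X : Type*} {eps : ℝ} {C : X → X → ℝ} {p : X → ℝ}
    (hCsym : ∀ x y, C x y = C y x) (z : X × X) :
    gibbsDensity eps C p z.swap = gibbsDensity eps C p z := by
  simp only [gibbsDensity, Prod.fst_swap, Prod.snd_swap, hCsym z.2, add_comm (p z.2)]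

section EntropicTransport

variable {X : Type*} [MetricSpace X] [CompactSpace X] [MeasurableSpace X] [BorelSpace X]
  {eps : ℝ} {C : X → X → ℝ} {alpha beta : Measure X}
  [IsProbabilityMeasure alpha] [IsProbabilityMeasure beta] {p f g : X → ℝ}

/-- A symmetric potential normalizes the marginal of its Gibbs density. -/
theorem integral_gibbsDensity_fst (heps : 0 < eps) (hC : Continuous fun z : X × X => C z.1 z.2)
    (hp : Continuous p) (hfix : p = Tmap eps C alpha p) (y : X) :
    ∫ x, gibbsDensity eps C p (x, y) ∂alpha = 1 := by
  have hcont : Continuous fun x => Real.exp ((p x - C x y) / eps) := by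
    have : Continuous fun x => C x y := hC.comp (by fun_prop : Continuous fun x : X => (x, y))
    fun_prop
  have hpos : 0 < ∫ x, Real.exp ((p x - C x y) / eps) ∂alpha :=
    integral_exp_pos hcont.integrable_of_compactSpace
  have hy : p y / eps = -Real.log (∫ x, Real.exp ((p x - C x y) / eps) ∂alpha) := by
    have := congrFun hfix y
    simp only [Tmap] at this
    rw [this]
    field_simp
  have hsplit : ∀ x, gibbsDensity eps C p (x, y) =
      Real.exp (p y / eps) * Real.exp ((p x - C x y) / eps) := fun x => by
    rw [gibbsDensity, ← Real.exp_add]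
    congr 1
    ring
  simp_rw [hsplit]
  rw [integral_const_mul, hy, Real.exp_neg, Real.exp_log hpos, inv_mul_cancel₀ hpos.ne']

theorem integral_one_sub_gibbsDensity_mul_snd (heps : 0 < eps)
    (hC : Continuous fun z : X × X => C z.1 z.2) (hp : Continuous p)
    (hfix : p = Tmap eps C alpha p) (hf : Continuous f) :
    ∫ z, (1 - gibbsDensity eps C p z) * f z.2 ∂(alpha.prod beta) = 0 := by
  have hw := continuous_gibbsDensity (eps := eps) hC hp
  rw [integral_prod_symm _ (Continuous.integrable_of_compactSpace (by fun_prop))]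
  have hslice : ∀ y, ∫ x, (1 - gibbsDensity eps C p (x, y)) * f y ∂alpha = 0 := fun y => by
    have hwy : Continuous fun x => gibbsDensity eps C p (x, y) := by fun_prop
    rw [integral_mul_const, integral_sub (integrable_const _) hwy.integrable_of_compactSpace,
      integral_gibbsDensity_fst heps hC hp hfix]
    simp
  simp [hslice]

theorem integral_one_sub_gibbsDensity_mul_fst (heps : 0 < eps)
    (hC : Continuous fun z : X × X => C z.1 z.2) (hCsym : ∀ x y, C x y = C y x)
    (hp : Continuous p) (hfix : p = Tmap eps C beta p) (hf : Continuous f) :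
    ∫ z, (1 - gibbsDensity eps C p z) * f z.1 ∂(alpha.prod beta) = 0 := by
  rw [← integral_one_sub_gibbsDensity_mul_snd (beta := alpha) heps hC hp hfix hf,
    ← integral_prod_swap]
  refine integral_congr_ae (Eventually.of_forall fun z => ?_)
  simp [gibbsDensity_swap hCsym z]

/-- The dual functional as a single integral over the product measure. -/
theorem Dfun_eq_integral_prod (hC : Continuous fun z : X × X => C z.1 z.2)
    (hf : Continuous f) (hg : Continuous g) :
    Dfun eps C alpha beta f g = ∫ z, (f z.1 + g z.2 -
      eps * (Real.exp ((f z.1 + g z.2 - C z.1 z.2) / eps) - 1)) ∂(alpha.prod beta) := by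
  have hexp : Continuous fun z : X × X =>
      Real.exp ((f z.1 + g z.2 - C z.1 z.2) / eps) - 1 := by fun_prop
  have hf1 : Continuous fun z : X × X => f z.1 := by fun_prop
  have hg2 : Continuous fun z : X × X => g z.2 := by fun_prop
  rw [integral_sub (hf1.fun_add hg2).integrable_of_compactSpace
      (hexp.const_mul eps).integrable_of_compactSpace,
    integral_add hf1.integrable_of_compactSpace hg2.integrable_of_compactSpace,
    integral_const_mul, integral_prod _ hexp.integrable_of_compactSpace,
    integral_fun_fst, integral_fun_snd]
  simp [Dfun]

/-- The dual functional is bounded by the cost of the product plan. -/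
theorem Dfun_le_integral_cost (heps : 0 < eps) (hC : Continuous fun z : X × X => C z.1 z.2)
    (hf : Continuous f) (hg : Continuous g) :
    Dfun eps C alpha beta f g ≤ ∫ z, C z.1 z.2 ∂(alpha.prod beta) := by
  rw [Dfun_eq_integral_prod hC hf hg]
  refine integral_mono (Continuous.integrable_of_compactSpace (by fun_prop))
    hC.integrable_of_compactSpace fun z => ?_
  have h := mul_le_mul_of_nonneg_left
    (Real.add_one_le_exp ((f z.1 + g z.2 - C z.1 z.2) / eps)) heps.le
  rw [mul_add, mul_div_cancel₀ _ heps.ne'] at h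
  dsimp only
  linarith

theorem Dfun_le_OTcost (heps : 0 < eps) (hC : Continuous fun z : X × X => C z.1 z.2)
    (hf : Continuous f) (hg : Continuous g) :
    Dfun eps C alpha beta f g ≤ OTcost eps C alpha beta := by
  refine le_csSup ⟨∫ z, C z.1 z.2 ∂(alpha.prod beta), ?_⟩ ⟨f, g, hf, hg, rfl⟩
  rintro r ⟨f', g', hf', hg', rfl⟩
  exact Dfun_le_integral_cost heps hC hf' hg'

theorem Dfun_self_potential (hC : Continuous fun z : X × X => C z.1 z.2) (hp : Continuous p)
    (hmass : ∫ z, (1 - gibbsDensity eps C p z) * (1 : ℝ) ∂(alpha.prod beta) = 0) :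
    Dfun eps C alpha beta p p = (∫ x, p x ∂alpha) + ∫ x, p x ∂beta := by
  have hw := continuous_gibbsDensity (eps := eps) hC hp
  have hmass' : ∫ z, (gibbsDensity eps C p z - 1) ∂(alpha.prod beta) = 0 := by
    rw [← neg_eq_zero, ← integral_neg]
    simpa using hmass
  rw [integral_prod _ (Continuous.integrable_of_compactSpace (by fun_prop))] at hmass'
  simp only [gibbsDensity] at hmass'
  rw [Dfun, hmass']
  ring

/-- The entropic self-transport cost is at most twice the integral of a symmetric potential. -/
theorem OTcost_self_le (heps : 0 < eps) (hC : Continuous fun z : X × X => C z.1 z.2)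
    (hCsym : ∀ x y, C x y = C y x) (hp : Continuous p) (hfix : p = Tmap eps C alpha p) :
    OTcost eps C alpha alpha ≤ 2 * ∫ x, p x ∂alpha := by
  refine csSup_le ⟨_, p, p, hp, hp, rfl⟩ ?_
  rintro r ⟨f, g, hf, hg, rfl⟩
  have hw := continuous_gibbsDensity (eps := eps) hC hp
  rw [Dfun_eq_integral_prod hC hf hg]
  have hp1 : Continuous fun z : X × X => p z.1 := by fun_prop
  have hp2 : Continuous fun z : X × X => p z.2 := by fun_prop
  have hf1 : Continuous fun z : X × X =>
      (1 - gibbsDensity eps C p z) * (f z.1 - p z.1 + eps) := by fun_prop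
  have hg2 : Continuous fun z : X × X =>
      (1 - gibbsDensity eps C p z) * (g z.2 - p z.2) := by fun_prop
  calc _ ≤ ∫ z, (p z.1 + p z.2 + ((1 - gibbsDensity eps C p z) * (f z.1 - p z.1 + eps) +
        (1 - gibbsDensity eps C p z) * (g z.2 - p z.2))) ∂(alpha.prod alpha) := by
        refine integral_mono (Continuous.integrable_of_compactSpace (by fun_prop))
          (Continuous.integrable_of_compactSpace (by fun_prop)) fun z => ?_
        set t := (f z.1 - p z.1 + (g z.2 - p z.2)) / eps with ht
        have hsplit : Real.exp ((f z.1 + g z.2 - C z.1 z.2) / eps) =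
            gibbsDensity eps C p z * Real.exp t := by
          rw [gibbsDensity, ← Real.exp_add]
          congr 1
          rw [ht]
          ring
        have hepst : eps * t = f z.1 - p z.1 + (g z.2 - p z.2) := by
          rw [ht, mul_div_cancel₀ _ heps.ne']
        have hwpos : 0 ≤ eps * gibbsDensity eps C p z := mul_nonneg heps.le (Real.exp_pos _).le
        have h := mul_le_mul_of_nonneg_left (Real.add_one_le_exp t) hwpos
        dsimp only
        rw [hsplit]
        linear_combination h - gibbsDensity eps C p z * hepst
    _ = 2 * ∫ x, p x ∂alpha := by
        rw [integral_add (hp1.fun_add hp2).integrable_of_compactSpace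
            (hf1.fun_add hg2).integrable_of_compactSpace,
          integral_add hp1.integrable_of_compactSpace hp2.integrable_of_compactSpace,
          integral_add hf1.integrable_of_compactSpace hg2.integrable_of_compactSpace,
          integral_one_sub_gibbsDensity_mul_fst (f := fun x => f x - p x + eps) heps hC hCsym hp
            hfix (by fun_prop),
          integral_one_sub_gibbsDensity_mul_snd (f := fun x => g x - p x) heps hC hp hfix
            (by fun_prop),
          integral_fun_fst, integral_fun_snd]
        simp
        ring

end EntropicTransport

/-- The Hausdorff divergence is dominated by the Sinkhorn
divergence: `½ ∫ (p_β - p_α) d(α - β) ≤ S_ε(α, β)`. -/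
theorem hausdorff_le_sinkhorn
    {X : Type*} [MetricSpace X] [CompactSpace X] [MeasurableSpace X] [BorelSpace X]
    (eps : ℝ) (heps : 0 < eps) (C : X → X → ℝ) (kappa : ℝ≥0) (hkappa : 0 < kappa)
    (hCsym : ∀ x y, C x y = C y x)
    (hClip1 : ∀ y, LipschitzWith kappa (fun x => C x y))
    (hClip2 : ∀ x, LipschitzWith kappa (fun y => C x y))
    (hpd : StrictPosDef (fun x y => Real.exp (-(C x y) / eps)))
    (alpha beta : Measure X) [IsProbabilityMeasure alpha] [IsProbabilityMeasure beta]
    (pa pb : X → ℝ) (hpa : Continuous pa) (hpb : Continuous pb)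
    (hfixa : pa = Tmap eps C alpha pa) (hfixb : pb = Tmap eps C beta pb) :
    (1/2) * ((∫ x, (pb x - pa x) ∂alpha) - ∫ x, (pb x - pa x) ∂beta)
      ≤ Sinkhorn eps C alpha beta := by
  have hC : Continuous fun z : X × X => C z.1 z.2 :=
    continuous_prod_of_continuous_lipschitzWith (Function.uncurry C) kappa
      (fun x => (hClip2 x).continuous) hClip1
  have hab := Dfun_le_OTcost (alpha := alpha) (beta := beta) heps hC hpa hpa
  have hba := Dfun_le_OTcost (alpha := alpha) (beta := beta) heps hC hpb hpb
  rw [Dfun_self_potential hC hpa (integral_one_sub_gibbsDensity_mul_snd (f := fun _ => 1)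
    heps hC hpa hfixa continuous_const)] at hab
  rw [Dfun_self_potential hC hpb (integral_one_sub_gibbsDensity_mul_fst (f := fun _ => 1)
    heps hC hCsym hpb hfixb continuous_const)] at hba
  have haa := OTcost_self_le heps hC hCsym hpa hfixa
  have hbb := OTcost_self_le heps hC hCsym hpb hfixb
  rw [integral_sub hpb.integrable_of_compactSpace hpa.integrable_of_compactSpace,
    integral_sub hpb.integrable_of_compactSpace hpa.integrable_of_compactSpace, Sinkhorn]
  linarith
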